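/- Let M be a compact metric space, f a continuous flow on M, ν an f-invariant ergodic Borel probability measure on M, γ : M → (0,∞) continuous, and g the time change of f with speed multiplier γ. Then the measure ν^γ (with density γ^{−1}·(∫γ^{−1}dν)^{−1} with respect to ν) is a g-invariant Borel probability measure, and g is ergodic with respect to ν^γ. -/

import Mathlib

open MeasureTheory intervalIntegral

/-- The additive cocycle over the flow `g` generated by `γ`:
`τ(t,x) = ∫₀^t γ(g^s x) ds`. -/
noncomputable def addCocycle {M : Type*} [TopologicalSpace M] (g : Flow ℝ M) (γ : M → ℝ)
    (t : ℝ) (x : M) : ℝ :=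
  ∫ s in (0 : ℝ)..t, γ (g s x)

/-- The flow `g` is a time change of `f` with speed multiplier `γ`. -/
def IsTimeChange {M : Type*} [TopologicalSpace M] (f g : Flow ℝ M) (γ : M → ℝ) : Prop :=
  ∀ t x, g t x = f (addCocycle g γ t x) x

/-- The measure `ν^γ`, with Radon–Nikodym derivative
`dν^γ/dν = γ⁻¹ · (∫ γ⁻¹ dν)⁻¹`. -/
noncomputable def nuGamma {M : Type*} [MeasurableSpace M] (ν : Measure M) (γ : M → ℝ) :
    Measure M :=
  ν.withDensity fun x => ENNReal.ofReal ((γ x)⁻¹ / ∫ y, (γ y)⁻¹ ∂ν)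

section Flow

variable {M : Type*} [TopologicalSpace M]

theorem Flow.continuous_orbit (g : Flow ℝ M) (x : M) : Continuous fun s => g s x :=
  g.continuous continuous_id continuous_const

theorem hasDerivAt_addCocycle (g : Flow ℝ M) {γ : M → ℝ} (hγ : Continuous γ) (x : M) (t : ℝ) :
    HasDerivAt (fun s => addCocycle g γ s x) (γ (g t x)) t :=
  ((hγ.comp (g.continuous_orbit x)).integral_hasStrictDerivAt 0 t).hasDerivAt

/-- On a compact space, the additive cocycle of a positive function takes every real value along
each orbit. -/
theorem addCocycle_surjective [CompactSpace M] (g : Flow ℝ M) {γ : M → ℝ} (hγ : Continuous γ)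
    (hpos : ∀ x, 0 < γ x) (x : M) : Function.Surjective fun t => addCocycle g γ t x := by
  have hcont : Continuous fun t => addCocycle g γ t x :=
    continuous_iff_continuousAt.2 fun t => (hasDerivAt_addCocycle g hγ x t).continuousAt
  obtain ⟨y, -, hy⟩ := isCompact_univ.exists_isMinOn ⟨x, Set.mem_univ x⟩ hγ.continuousOn
  have hmono : Monotone fun t => addCocycle g γ t x - γ y * t := by
    refine monotone_of_hasDerivAt_nonneg (f' := fun t => γ (g t x) - γ y) (fun t => ?_)
      (fun t => sub_nonneg.2 (hy (Set.mem_univ _)))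
    simpa using (hasDerivAt_addCocycle g hγ x t).fun_sub ((hasDerivAt_id' t).const_mul (γ y))
  have hzero : addCocycle g γ 0 x = 0 := integral_same
  refine hcont.surjective ?_ ?_
  · refine Filter.tendsto_atTop_mono' _ ?_ (Filter.tendsto_id.const_mul_atTop (hpos y))
    filter_upwards [Filter.eventually_ge_atTop 0] with t ht
    have := hmono ht
    simp only [hzero, mul_zero, sub_zero] at this
    simpa using this
  · refine Filter.tendsto_atBot_mono' _ ?_ (Filter.tendsto_id.const_mul_atBot (hpos y))
    filter_upwards [Filter.eventually_le_atBot 0] with t ht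
    have := hmono ht
    simp only [hzero, mul_zero, sub_zero] at this
    simpa using this

/-- The orbit segments of a time change are orbit segments of the original flow. -/
theorem IsTimeChange.exists_apply_eq [CompactSpace M] {f g : Flow ℝ M} {γ : M → ℝ}
    (hg : IsTimeChange f g γ) (hγ : Continuous γ) (hpos : ∀ x, 0 < γ x) (u : ℝ) (x : M) :
    ∃ t, addCocycle g γ t x = u ∧ g t x = f u x := by
  obtain ⟨t, rfl⟩ := addCocycle_surjective g hγ hpos x u
  exact ⟨t, rfl, hg t x⟩

theorem IsTimeChange.image_eq [CompactSpace M] {f g : Flow ℝ M} {γ : M → ℝ}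
    (hg : IsTimeChange f g γ) (hγ : Continuous γ) (hpos : ∀ x, 0 < γ x) {J : Set M}
    (hJ : ∀ t, g t '' J = J) (u : ℝ) : f u '' J = J := by
  have hmem : ∀ u, ∀ x ∈ J, f u x ∈ J := fun u x hx => by
    obtain ⟨t, -, ht⟩ := hg.exists_apply_eq hγ hpos u x
    rw [← ht, ← hJ t]
    exact Set.mem_image_of_mem _ hx
  refine Set.Subset.antisymm (Set.image_subset_iff.2 (hmem u)) fun x hx =>
    ⟨f (-u) x, hmem _ x hx, ?_⟩
  rw [← f.map_add, add_neg_cancel, f.map_zero_apply]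

/-- Change of variables between the two parametrizations of an orbit segment. -/
theorem IsTimeChange.integral_orbit {f g : Flow ℝ M} {γ : M → ℝ}
    (hg : IsTimeChange f g γ) (hγ : Continuous γ) (hpos : ∀ x, 0 < γ x) {φ : M → ℝ}
    (hφ : Continuous φ) (x : M) (S : ℝ) :
    ∫ u in (0 : ℝ)..addCocycle g γ S x, (γ (f u x))⁻¹ * φ (f u x) =
      ∫ s in (0 : ℝ)..S, φ (g s x) := by
  have hcont : Continuous fun u => (γ (f u x))⁻¹ * φ (f u x) :=
    ((hγ.comp (f.continuous_orbit x)).inv₀ fun u => (hpos _).ne').mul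
      (hφ.comp (f.continuous_orbit x))
  have h := integral_comp_mul_deriv (a := 0) (b := S)
    (fun s _ => hasDerivAt_addCocycle g hγ x s)
    (hγ.comp (g.continuous_orbit x)).continuousOn hcont
  have hzero : addCocycle g γ 0 x = 0 := integral_same
  rw [hzero] at h
  rw [← h]
  refine integral_congr fun s _ => ?_
  have := (hpos (g s x)).ne'
  simp only [Function.comp_apply, ← hg s x]
  field_simp

/-- The integral of the coboundary `φ ∘ g^t - φ` along an orbit segment is bounded independently
of its length. -/
theorem Flow.abs_integral_coboundary_le (g : Flow ℝ M) {φ : M → ℝ} (hφ : Continuous φ) {C : ℝ}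
    (hC : ∀ y, |φ y| ≤ C) (t S : ℝ) (x : M) :
    |∫ s in (0 : ℝ)..S, (φ (g t (g s x)) - φ (g s x))| ≤ 2 * (C * |t|) := by
  have h_int : ∀ a b, IntervalIntegrable (fun s => φ (g s x)) volume a b :=
    fun a b => (hφ.comp (g.continuous_orbit x)).intervalIntegrable a b
  have hshift : ∫ s in (0 : ℝ)..S, φ (g t (g s x)) = ∫ s in t..(S + t), φ (g s x) := by
    have h := integral_comp_add_right (a := 0) (b := S) (fun s => φ (g s x)) t
    simpa only [add_comm _ t, g.map_add, add_zero] using h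
  have hbound : ∀ a, |∫ s in a..(a + t), φ (g s x)| ≤ C * |t| := fun a => by
    simpa using norm_integral_le_of_norm_le_const (a := a) (b := a + t)
      (f := fun s => φ (g s x)) fun s _ => hC (g s x)
  have h_int' : IntervalIntegrable (fun s => φ (g t (g s x))) volume 0 S :=
    ((hφ.comp (g.continuous_toFun t)).comp (g.continuous_orbit x)).intervalIntegrable _ _
  rw [integral_sub h_int' (h_int _ _), hshift,
    integral_interval_sub_interval_comm (h_int _ _) (h_int _ _) (h_int _ _),
    integral_symm 0 t, integral_symm S]
  have h0 := hbound 0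
  have hS := hbound S
  rw [zero_add] at h0
  rw [abs_le] at h0 hS ⊢
  constructor <;> linarith [h0.1, h0.2, hS.1, hS.2]

end Flow

section Measure

variable {M : Type*} [MetricSpace M] [CompactSpace M] [MeasurableSpace M] [BorelSpace M]

theorem Continuous.integrable_of_compactSpace {ν : Measure M} [IsFiniteMeasure ν] {ψ : M → ℝ}
    (hψ : Continuous ψ) : Integrable ψ ν :=
  hψ.integrable_of_hasCompactSupport (HasCompactSupport.of_compactSpace ψ)

/-- A continuous function whose integrals over orbit segments are uniformly bounded has
zero mean with respect to every invariant measure. -/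
theorem Flow.integral_eq_zero_of_orbit_bounded (f : Flow ℝ M) {ν : Measure M}
    [IsProbabilityMeasure ν] (hinv : ∀ t : ℝ, MeasurePreserving (f t) ν ν) {ψ : M → ℝ}
    (hψ : Continuous ψ) {K : ℝ} (hK : ∀ x T, |∫ u in (0 : ℝ)..T, ψ (f u x)| ≤ K) :
    ∫ x, ψ x ∂ν = 0 := by
  obtain ⟨C, hC⟩ := isCompact_univ.exists_bound_of_continuousOn hψ.continuousOn
  have hcont : Continuous fun p : M × ℝ => ψ (f p.2 p.1) :=
    hψ.comp (f.continuous continuous_snd continuous_fst)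
  have hmean : ∀ T : ℝ, 0 ≤ T → T * ∫ x, ψ x ∂ν = ∫ x, (∫ u in (0 : ℝ)..T, ψ (f u x)) ∂ν := by
    intro T hT
    have h_int : Integrable (fun p : M × ℝ => ψ (f p.2 p.1))
        (ν.prod (volume.restrict (Set.Ioc 0 T))) :=
      .of_bound hcont.aestronglyMeasurable C (.of_forall fun p => hC _ (Set.mem_univ _))
    have hcomp : ∀ u, ∫ x, ψ (f u x) ∂ν = ∫ x, ψ x ∂ν := fun u => by
      conv_rhs => rw [← (hinv u).map_eq]
      exact (integral_map (hinv u).measurable.aemeasurable hψ.aestronglyMeasurable).symm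
    simp only [integral_of_le hT]
    rw [integral_integral_swap h_int]
    simp [hcomp, hT]
  have hle : ∀ T : ℝ, 0 ≤ T → T * |∫ x, ψ x ∂ν| ≤ K := fun T hT => by
    rw [show T * |∫ x, ψ x ∂ν| = |T * ∫ x, ψ x ∂ν| by rw [abs_mul, abs_of_nonneg hT], hmean T hT]
    simpa using MeasureTheory.norm_integral_le_of_norm_le_const (μ := ν)
      (f := fun x => ∫ u in (0 : ℝ)..T, ψ (f u x)) (.of_forall fun x => hK x T)
  by_contra h
  have hpos := abs_pos.2 h
  have hKnonneg : 0 ≤ K := by simpa using hle 0 le_rfl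
  have := hle ((K + 1) / |∫ x, ψ x ∂ν|) (by positivity)
  rw [div_mul_cancel₀ _ hpos.ne'] at this
  linarith

theorem integral_inv_pos {γ : M → ℝ} (hγ : Continuous γ) (hpos : ∀ x, 0 < γ x)
    (ν : Measure M) [IsProbabilityMeasure ν] :
    0 < ∫ y, (γ y)⁻¹ ∂ν := by
  refine (integral_pos_iff_support_of_nonneg (fun y => (inv_pos.2 (hpos y)).le)
    (hγ.inv₀ fun y => (hpos y).ne').integrable_of_compactSpace).2 ?_
  have : Function.support (fun y => (γ y)⁻¹) = Set.univ :=
    Set.eq_univ_of_forall fun y => (inv_pos.2 (hpos y)).ne'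
  simp [this]

theorem isProbabilityMeasure_nuGamma {γ : M → ℝ} (hγ : Continuous γ) (hpos : ∀ x, 0 < γ x)
    (ν : Measure M) [IsProbabilityMeasure ν] :
    IsProbabilityMeasure (nuGamma ν γ) := by
  have hc := integral_inv_pos hγ hpos ν
  refine ⟨?_⟩
  rw [nuGamma, withDensity_apply _ .univ, Measure.restrict_univ,
    ← ofReal_integral_eq_lintegral_ofReal, MeasureTheory.integral_div,
    div_self hc.ne', ENNReal.ofReal_one]
  · exact (hγ.inv₀ fun y => (hpos y).ne').integrable_of_compactSpace.div_const _
  · exact .of_forall fun x => (div_pos (inv_pos.2 (hpos x)) hc).le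

theorem integral_nuGamma {γ : M → ℝ} (hγ : Continuous γ) (hpos : ∀ x, 0 < γ x)
    (ν : Measure M) [IsProbabilityMeasure ν] (φ : M → ℝ) :
    ∫ x, φ x ∂(nuGamma ν γ) = (∫ x, (γ x)⁻¹ * φ x ∂ν) / ∫ y, (γ y)⁻¹ ∂ν := by
  have hc := integral_inv_pos hγ hpos ν
  have hmeas : Measurable γ := hγ.measurable
  rw [nuGamma, integral_withDensity_eq_integral_toReal_smul
    (by fun_prop) (.of_forall fun x => ENNReal.ofReal_lt_top),
    ← MeasureTheory.integral_div]
  refine integral_congr_ae (.of_forall fun x => ?_)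
  simp only [ENNReal.toReal_ofReal (div_pos (inv_pos.2 (hpos x)) hc).le, smul_eq_mul]
  ring

theorem measurePreserving_nuGamma {γ : M → ℝ} (hγ : Continuous γ) (hpos : ∀ x, 0 < γ x)
    (ν : Measure M) [IsProbabilityMeasure ν]
    {f g : Flow ℝ M} (hg : IsTimeChange f g γ)
    (hinv : ∀ t : ℝ, MeasurePreserving (f t) ν ν) (t : ℝ) :
    MeasurePreserving (g t) (nuGamma ν γ) (nuGamma ν γ) := by
  have := isProbabilityMeasure_nuGamma hγ hpos ν
  have hmeas : Measurable (g t) := (g.continuous_toFun t).measurable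
  have hγinv : Continuous fun x => (γ x)⁻¹ := hγ.inv₀ fun y => (hpos y).ne'
  refine ⟨hmeas, ?_⟩
  have : IsFiniteMeasure ((nuGamma ν γ).map (g t)) := Measure.isFiniteMeasure_map _ _
  refine ext_of_forall_integral_eq_of_IsFiniteMeasure fun φ => ?_
  have hφt : Continuous fun x => φ (g t x) := φ.continuous.comp (g.continuous_toFun t)
  rw [integral_map hmeas.aemeasurable φ.continuous.aestronglyMeasurable,
    integral_nuGamma hγ hpos, integral_nuGamma hγ hpos]
  congr 1
  rw [← sub_eq_zero, ← MeasureTheory.integral_sub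
    (hγinv.fun_mul hφt).integrable_of_compactSpace
    (hγinv.fun_mul φ.continuous).integrable_of_compactSpace]
  simp only [← mul_sub]
  refine f.integral_eq_zero_of_orbit_bounded hinv (hγinv.mul (hφt.fun_sub φ.continuous))
    (K := 2 * (‖φ‖ * |t|)) fun x T => ?_
  obtain ⟨S, rfl, -⟩ := hg.exists_apply_eq hγ hpos T x
  rw [hg.integral_orbit hγ hpos (hφt.fun_sub φ.continuous)]
  exact g.abs_integral_coboundary_le φ.continuous φ.norm_coe_le_norm t S x

end Measure

/-- If `ν` is an `f`-invariant ergodic Borel probability measure and `g` is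
the time change of `f` with speed multiplier `γ`, then `ν^γ` is a `g`-invariant Borel
probability measure and `g` is ergodic with respect to `ν^γ`. -/
theorem stmt6 {M : Type*} [MetricSpace M] [CompactSpace M]
    [MeasurableSpace M] [BorelSpace M]
    (f g : Flow ℝ M) (γ : M → ℝ) (hγc : Continuous γ) (hγpos : ∀ x, 0 < γ x)
    (hg : IsTimeChange f g γ)
    (ν : Measure M) [IsProbabilityMeasure ν]
    (hinv : ∀ t : ℝ, MeasurePreserving (f t) ν ν)
    (herg : ∀ J : Set M, MeasurableSet J → (∀ t : ℝ, f t '' J = J) → ν J = 0 ∨ ν J = 1) :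
    IsProbabilityMeasure (nuGamma ν γ) ∧
    (∀ t : ℝ, MeasurePreserving (g t) (nuGamma ν γ) (nuGamma ν γ)) ∧
    (∀ J : Set M, MeasurableSet J → (∀ t : ℝ, g t '' J = J) →
      nuGamma ν γ J = 0 ∨ nuGamma ν γ J = 1) := by
  have hprob := isProbabilityMeasure_nuGamma hγc hγpos ν
  refine ⟨hprob, measurePreserving_nuGamma hγc hγpos ν hg hinv, fun J hJ hgJ => ?_⟩
  have hac : nuGamma ν γ ≪ ν := withDensity_absolutelyContinuous ν _
  refine (herg J hJ (hg.image_eq hγc hγpos hgJ)).imp (fun h => hac h) fun h => ?_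
  rw [← prob_compl_eq_zero_iff hJ] at h ⊢
  exact hac h
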